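/- arXiv:1811.01234 — 10 statements merged into one kernel-verified Lean document; each statement's English description precedes it below -/
import Mathlib

section
/- If a, b ∈ K satisfy a ≤ b, then U_b ⊆ U_a. -/
/-- A subset `S` of a partially ordered set is *upward directed* if any two of its
elements have an upper bound in `S`. -/
def IsUpDirected {K : Type*} [PartialOrder K] (S : Set K) : Prop :=
  ∀ a ∈ S, ∀ b ∈ S, ∃ c ∈ S, a ≤ c ∧ b ≤ c

/-- A *maximal upward directed subset*: upward directed and maximal with respect to
inclusion among upward directed subsets. -/
def IsMaxUpDirected {K : Type*} [PartialOrder K] (S : Set K) : Prop :=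
  IsUpDirected S ∧ ∀ T : Set K, IsUpDirected T → S ⊆ T → T = S

/-- The index set `I` of all maximal upward directed subsets of `K`. -/
def Idx (K : Type*) [PartialOrder K] := {S : Set K // IsMaxUpDirected S}

/-- `U a = { S ∈ I : a ∈ S }`. -/
def U {K : Type*} [PartialOrder K] (a : K) : Set (Idx K) := {S : Idx K | a ∈ S.1}

/-- The lower closure of an upward directed set is upward directed. -/
theorem IsUpDirected.lowerClosure {K : Type*} [PartialOrder K] {S : Set K}
    (hS : IsUpDirected S) : IsUpDirected (lowerClosure S : Set K) := by
  rintro x ⟨s, hs, hxs⟩ y ⟨t, ht, hyt⟩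
  obtain ⟨c, hc, hsc, htc⟩ := hS s hs t ht
  exact ⟨c, subset_lowerClosure hc, hxs.trans hsc, hyt.trans htc⟩

/-- A maximal upward directed set is a lower set. -/
theorem IsMaxUpDirected.isLowerSet {K : Type*} [PartialOrder K] {S : Set K}
    (hS : IsMaxUpDirected S) : IsLowerSet S := by
  rw [← hS.2 _ hS.1.lowerClosure subset_lowerClosure]
  exact (lowerClosure S).lower

/-- If `a ≤ b` then `U b ⊆ U a`. -/
theorem U_antitone {K : Type*} [PartialOrder K] (a b : K) (h : a ≤ b) :
    U b ⊆ U a := by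
  intro S hS
  exact S.2.isLowerSet h hS
end

section
/- The topological space (I, τ) is a T1-space: for any two distinct points S, T ∈ I there is a τ-open set containing S and not T. -/
/-- The topology `τ` on `I` generated by the family `{U a : a ∈ K}`. -/
def tau (K : Type*) [PartialOrder K] : TopologicalSpace (Idx K) :=
  TopologicalSpace.generateFrom (Set.range (fun a : K => U a))

/-- The topological space `(I, τ)` is a `T₁`-space: for any two distinct points
`S, T ∈ I` there is a `τ`-open set containing `S` and not `T`. -/
theorem tau_t1 {K : Type*} [PartialOrder K] (S T : Idx K) (hST : S ≠ T) :
    ∃ V : Set (Idx K), (tau K).IsOpen V ∧ S ∈ V ∧ T ∉ V := by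
  obtain ⟨a, haS, haT⟩ : ∃ a ∈ S.1, a ∉ T.1 :=
    Set.not_subset.mp fun h => hST (Subtype.ext (S.2.2 T.1 T.2.1 h).symm)
  exact ⟨U a, TopologicalSpace.isOpen_generateFrom_of_mem ⟨a, rfl⟩, haS, haT⟩
end

section
/- For every point S ∈ I, the one-point set {S} is closed in the topological space (I, τ). -/
/-- For every point `S ∈ I` the one-point set `{S}` is closed in `(I, τ)`. -/
theorem singleton_closed {K : Type*} [PartialOrder K] (S : Idx K) :
    @IsClosed _ (tau K) ({S} : Set (Idx K)) := by
  let _ := tau K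
  have h : ({S} : Set (Idx K))ᶜ = ⋃ a ∈ (S.1)ᶜ, U a := by
    ext T
    simp only [Set.mem_compl_iff, Set.mem_singleton_iff, Set.mem_iUnion, exists_prop]
    constructor
    · intro hne
      by_contra! hT
      have hsub : T.1 ⊆ S.1 := fun a ha => by_contra fun haS => hT a haS ha
      exact hne (Subtype.ext (T.2.2 S.1 S.2.1 hsub).symm)
    · rintro ⟨a, haS, haT⟩ rfl
      exact haS haT
  rw [← isOpen_compl_iff, h]
  exact isOpen_biUnion fun a _ => TopologicalSpace.isOpen_generateFrom_of_mem ⟨a, rfl⟩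
end

section
/- For a ∈ K, the set K^a := {b ∈ K : a ≤ b} is upward directed if and only if U_a consists of a single point, i.e., there exists S ∈ I with U_a = {S}. -/
/-- Every upward directed set is contained in a maximal one. -/
lemma IsUpDirected.exists_isMaxUpDirected {K : Type*} [PartialOrder K] {S : Set K}
    (hS : IsUpDirected S) : ∃ M : Set K, S ⊆ M ∧ IsMaxUpDirected M := by
  obtain ⟨M, hSM, hM⟩ := zorn_subset_nonempty {T : Set K | IsUpDirected T} (by
    intro C hC hchain _
    refine ⟨⋃₀ C, ?_, fun T hT => Set.subset_sUnion_of_mem hT⟩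
    rintro x ⟨T, hT, hx⟩ y ⟨T', hT', hy⟩
    obtain h | h := hchain.total hT hT'
    · obtain ⟨z, hz, hxz, hyz⟩ := hC hT' x (h hx) y hy
      exact ⟨z, ⟨T', hT', hz⟩, hxz, hyz⟩
    · obtain ⟨z, hz, hxz, hyz⟩ := hC hT x hx y (h hy)
      exact ⟨z, ⟨T, hT, hz⟩, hxz, hyz⟩) S hS
  exact ⟨M, hSM, hM.prop, fun T hT hMT => (hM.eq_of_subset hT hMT).symm⟩

lemma isUpDirected_pair {K : Type*} [PartialOrder K] {a b : K} (hab : a ≤ b) :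
    IsUpDirected {a, b} := by
  have h : ∀ x ∈ ({a, b} : Set K), x ≤ b := by
    rintro x (rfl | rfl)
    exacts [hab, le_rfl]
  exact fun x hx y hy => ⟨b, Or.inr rfl, h x hx, h y hy⟩

/-- An upward directed set containing `a` lies below the elements above `a`. -/
lemma IsUpDirected.subset_lowerClosure_Ici {K : Type*} [PartialOrder K] {S : Set K} {a : K}
    (hS : IsUpDirected S) (ha : a ∈ S) : S ⊆ {x : K | ∃ c, a ≤ c ∧ x ≤ c} := fun x hx =>
  let ⟨c, _, hac, hxc⟩ := hS a ha x hx
  ⟨c, hac, hxc⟩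

/-- For `a ∈ K`, the set `K^a = {b ∈ K : a ≤ b}` is upward directed if and only if
`U a` consists of a single point of `I`. -/
theorem upDirected_iff_U_singleton {K : Type*} [PartialOrder K] (a : K) :
    IsUpDirected {b : K | a ≤ b} ↔ ∃ S : Idx K, U a = {S} := by
  constructor
  · intro h
    have hL : IsUpDirected {x : K | ∃ c, a ≤ c ∧ x ≤ c} := by
      rintro x ⟨c, hac, hxc⟩ y ⟨d, had, hyd⟩
      obtain ⟨e, hae, hce, hde⟩ := h c hac d had
      exact ⟨e, ⟨e, hae, le_rfl⟩, hxc.trans hce, hyd.trans hde⟩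
    have haL : a ∈ {x : K | ∃ c, a ≤ c ∧ x ≤ c} := ⟨a, le_rfl, le_rfl⟩
    refine ⟨⟨_, hL, fun T hT hLT =>
      (hT.subset_lowerClosure_Ici (hLT haL)).antisymm hLT⟩, Set.eq_singleton_iff_unique_mem.2
        ⟨haL, fun S hS => Subtype.ext ?_⟩⟩
    exact (S.2.2 _ hL (S.2.1.subset_lowerClosure_Ici hS)).symm
  · rintro ⟨S, hS⟩
    have hmem : ∀ b, a ≤ b → b ∈ S.1 := by
      intro b hab
      obtain ⟨M, hsub, hM⟩ := (isUpDirected_pair hab).exists_isMaxUpDirected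
      have hMU : (⟨M, hM⟩ : Idx K) ∈ U a := hsub (Or.inl rfl)
      have hMS : M = S.1 := congrArg Subtype.val (hS.subset hMU)
      exact hMS ▸ hsub (Or.inr rfl)
    intro b hb c hc
    obtain ⟨d, _, hbd, hcd⟩ := S.2.1 b (hmem b hb) c (hmem c hc)
    exact ⟨d, le_trans hb hbd, hbd, hcd⟩
end

section
/- Let a ∈ K and suppose the set K^a := {b ∈ K : a ≤ b} is upward directed. If S is a maximal upward directed subset of K with K^a ⊆ S, then U_a = {S}. -/
/-- If the elements above `a` form an upward directed set, then so does its lower closure. -/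
theorem IsUpDirected.lowerClosure_above {K : Type*} [PartialOrder K] {a : K}
    (hKa : IsUpDirected {b : K | a ≤ b}) : IsUpDirected {x : K | ∃ c, a ≤ c ∧ x ≤ c} := by
  rintro x ⟨c, hac, hxc⟩ y ⟨d, had, hyd⟩
  obtain ⟨e, hae, hce, hde⟩ := hKa c hac d had
  exact ⟨e, ⟨e, hae, le_rfl⟩, hxc.trans hce, hyd.trans hde⟩

/-- A maximal upward directed set containing `a` is the lower closure of the elements above `a`,
provided these form an upward directed set. -/
theorem IsMaxUpDirected.eq_lowerClosure_above {K : Type*} [PartialOrder K] {a : K} {T : Set K}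
    (hT : IsMaxUpDirected T) (hKa : IsUpDirected {b : K | a ≤ b}) (haT : a ∈ T) :
    {x : K | ∃ c, a ≤ c ∧ x ≤ c} = T := by
  refine hT.2 _ hKa.lowerClosure_above fun x hx => ?_
  obtain ⟨c, -, hac, hxc⟩ := hT.1 a haT x hx
  exact ⟨c, hac, hxc⟩

/-- If `K^a = {b : a ≤ b}` is upward directed and `S` is a maximal upward directed
subset containing `K^a`, then `U a = {S}`. -/
theorem U_singleton_of_upDirected {K : Type*} [PartialOrder K] (a : K)
    (hKa : IsUpDirected {b : K | a ≤ b})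
    (S : Set K) (hS : IsMaxUpDirected S) (hsub : {b : K | a ≤ b} ⊆ S) :
    U a = {(⟨S, hS⟩ : Idx K)} := by
  have haS : a ∈ S := hsub le_rfl
  ext T
  refine ⟨fun haT => ?_, fun hTS => ?_⟩
  · exact Subtype.ext ((T.2.eq_lowerClosure_above hKa haT).symm.trans
      (hS.eq_lowerClosure_above hKa haS))
  · obtain rfl : T = ⟨S, hS⟩ := hTS
    exact haS
end

section
/- Let K := {(x, y) ∈ ℤ × ℤ : x ∈ {-1, 0, 1}} with the partial order: (x₁, y₁) ≤ (x₂, y₂) iff (x₁, y₁) = (x₂, y₂), or (x₁ = x₂ and x₁ ∈ {-1, 1} and y₁ ≤ y₂), or (x₁ ∈ {-1, 1} and x₂ = 0 and y₁ < y₂). Then the topological space (I, τ) is not a Hausdorff space; in particular, the sets K₋ := {(-1, y) : y ∈ ℤ} and K₊ := {(1, y) : y ∈ ℤ} are distinct maximal upward directed subsets of K that cannot be separated by disjoint τ-open sets. -/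
/-- A subset `S` is *upward directed* with respect to a relation `r` if any two of
its elements have an `r`-upper bound in `S`. -/
def IsUpDirectedRel {α : Type*} (r : α → α → Prop) (S : Set α) : Prop :=
  ∀ a ∈ S, ∀ b ∈ S, ∃ c ∈ S, r a c ∧ r b c

/-- A *maximal upward directed subset* with respect to `r`: upward directed and
maximal with respect to inclusion among upward directed subsets. -/
def IsMaxUpDirectedRel {α : Type*} (r : α → α → Prop) (S : Set α) : Prop :=
  IsUpDirectedRel r S ∧ ∀ T : Set α, IsUpDirectedRel r T → S ⊆ T → T = S

/-- The index set `I` of all maximal upward directed subsets. -/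
def IdxRel {α : Type*} (r : α → α → Prop) := {S : Set α // IsMaxUpDirectedRel r S}

/-- `U a = { S ∈ I : a ∈ S }`. -/
def URel {α : Type*} (r : α → α → Prop) (a : α) : Set (IdxRel r) :=
  {S : IdxRel r | a ∈ S.1}

/-- The topology `τ` on `I` generated by the family `{U a}`. -/
def tauRel {α : Type*} (r : α → α → Prop) : TopologicalSpace (IdxRel r) :=
  TopologicalSpace.generateFrom (Set.range (fun a : α => URel r a))

/-- The set `K = {(x, y) ∈ ℤ × ℤ : x ∈ {-1, 0, 1}}` as a type. -/
def K11 : Type := {p : ℤ × ℤ // p.1 = -1 ∨ p.1 = 0 ∨ p.1 = 1}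

/-- The partial order on `K11`: `(x₁,y₁) ≤ (x₂,y₂)` iff they are equal, or
`x₁ = x₂ ∈ {-1,1}` and `y₁ ≤ y₂`, or `x₁ ∈ {-1,1}`, `x₂ = 0` and `y₁ < y₂`. -/
def le11 (p q : K11) : Prop :=
  p = q ∨ (p.1.1 = q.1.1 ∧ (p.1.1 = -1 ∨ p.1.1 = 1) ∧ p.1.2 ≤ q.1.2) ∨
    ((p.1.1 = -1 ∨ p.1.1 = 1) ∧ q.1.1 = 0 ∧ p.1.2 < q.1.2)

/-- `K₋ = {(-1, y) : y ∈ ℤ}`. -/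
def Kneg : Set K11 := {p : K11 | p.1.1 = -1}

/-- `K₊ = {(1, y) : y ∈ ℤ}`. -/
def Kpos : Set K11 := {p : K11 | p.1.1 = 1}

/-- The column `{(s, y) : y ∈ ℤ}`. -/
def column11 (s : ℤ) : Set K11 := {p : K11 | p.1.1 = s}

/-- The point `(0, n)`. -/
def center11 (n : ℤ) : K11 := ⟨(0, n), Or.inr (Or.inl rfl)⟩

/-- The principal down-set of `(0, n)`. -/
def lowerCenter11 (n : ℤ) : Set K11 := {p : K11 | le11 p (center11 n)}

theorem eq_of_le11_of_fst_eq_zero {p q : K11} (hp : p.1.1 = 0) (h : le11 p q) : q = p := by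
  rcases h with h | ⟨-, h, -⟩ | ⟨h, -⟩
  · exact h.symm
  all_goals omega

theorem isMaxUpDirectedRel_column11 {s : ℤ} (hs : s = -1 ∨ s = 1) :
    IsMaxUpDirectedRel le11 (column11 s) := by
  have hs' : s = -1 ∨ s = 0 ∨ s = 1 := by omega
  refine ⟨fun a ha b hb => ⟨⟨(s, max a.1.2 b.1.2), hs'⟩, rfl,
    Or.inr (Or.inl ⟨ha, ?_, le_max_left _ _⟩), Or.inr (Or.inl ⟨hb, ?_, le_max_right _ _⟩)⟩,
    fun T hT hsub => (Set.Subset.antisymm hsub fun t ht => ?_).symm⟩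
  · rw [show a.1.1 = s from ha]; exact hs
  · rw [show b.1.1 = s from hb]; exact hs
  have hzero : ∀ c ∈ T, c.1.1 ≠ 0 := by
    intro c hc h0
    obtain ⟨d, -, hcd, hd⟩ := hT c hc ⟨(s, c.1.2), hs'⟩ (hsub rfl)
    obtain rfl := eq_of_le11_of_fst_eq_zero h0 hcd
    rcases hd with h | ⟨h, -⟩ | ⟨-, -, h⟩
    · rw [← h] at h0
      change s = 0 at h0
      omega
    · change s = _ at h
      omega
    · exact lt_irrefl _ h
  obtain ⟨c, hc, htc, hsc⟩ := hT t ht ⟨(s, 0), hs'⟩ (hsub rfl)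
  have hc0 := hzero c hc
  have hcs : c.1.1 = s := by
    rcases hsc with h | ⟨h, -⟩ | ⟨-, h, -⟩
    · rw [← h]
    · exact h.symm
    · exact absurd h hc0
  rcases htc with h | ⟨h, -⟩ | ⟨-, h, -⟩
  · rw [h]; exact hcs
  · exact h.trans hcs
  · exact absurd h hc0

theorem isMaxUpDirectedRel_lowerCenter11 (n : ℤ) :
    IsMaxUpDirectedRel le11 (lowerCenter11 n) := by
  refine ⟨fun a ha b hb => ⟨center11 n, Or.inl rfl, ha, hb⟩,
    fun T hT hsub => (Set.Subset.antisymm hsub fun t ht => ?_).symm⟩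
  obtain ⟨c, -, htc, hnc⟩ := hT t ht (center11 n) (hsub (Or.inl rfl))
  obtain rfl := eq_of_le11_of_fst_eq_zero rfl hnc
  exact htc

/-- The down-sets of `(0, n)` converge to both outer columns as `n → ∞`. -/
theorem tendsto_lowerCenter11 {s : ℤ} (hs : s = -1 ∨ s = 1)
    (h : IsMaxUpDirectedRel le11 (column11 s)) :
    Filter.Tendsto
      (fun n : ℤ => (⟨lowerCenter11 n, isMaxUpDirectedRel_lowerCenter11 n⟩ : IdxRel le11))
      Filter.atTop (@nhds _ (tauRel le11) ⟨column11 s, h⟩) := by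
  refine TopologicalSpace.tendsto_nhds_generateFrom_iff.2 ?_
  rintro _ ⟨a, rfl⟩ (ha : a.1.1 = s)
  filter_upwards [Filter.eventually_gt_atTop a.1.2] with n hn
  exact Or.inr (Or.inr ⟨by rw [ha]; exact hs, rfl, hn⟩)

/-- `(I, τ)` is not Hausdorff: `K₋` and `K₊` are distinct maximal upward directed
subsets of `K` which cannot be separated by disjoint `τ`-open sets. -/
theorem not_hausdorff :
    IsMaxUpDirectedRel le11 Kneg ∧ IsMaxUpDirectedRel le11 Kpos ∧ Kneg ≠ Kpos ∧
    (∀ (hn : IsMaxUpDirectedRel le11 Kneg) (hp : IsMaxUpDirectedRel le11 Kpos)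
        (V W : Set (IdxRel le11)),
      (tauRel le11).IsOpen V → (tauRel le11).IsOpen W →
      (⟨Kneg, hn⟩ : IdxRel le11) ∈ V → (⟨Kpos, hp⟩ : IdxRel le11) ∈ W →
      (V ∩ W).Nonempty) ∧
    ¬ @T2Space (IdxRel le11) (tauRel le11) := by
  have hneg : IsMaxUpDirectedRel le11 Kneg := isMaxUpDirectedRel_column11 (Or.inl rfl)
  have hpos : IsMaxUpDirectedRel le11 Kpos := isMaxUpDirectedRel_column11 (Or.inr rfl)
  have hne : Kneg ≠ Kpos := by
    intro h
    have hmem : (⟨(-1, 0), Or.inl rfl⟩ : K11) ∈ Kpos := h ▸ (rfl : (-1 : ℤ) = -1)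
    have : (-1 : ℤ) = 1 := hmem
    omega
  refine ⟨hneg, hpos, hne, fun hn hp V W hV hW hnV hpW => ?_, fun hT2 => ?_⟩
  · let _ := tauRel le11
    obtain ⟨n, hnV', hnW'⟩ :=
      (((tendsto_lowerCenter11 (Or.inl rfl) hn).eventually
          (IsOpen.mem_nhds (X := IdxRel le11) hV hnV)).and
        ((tendsto_lowerCenter11 (Or.inr rfl) hp).eventually
          (IsOpen.mem_nhds (X := IdxRel le11) hW hpW))).exists
    exact ⟨_, hnV', hnW'⟩
  · let _ := tauRel le11
    exact hne (congrArg Subtype.val (tendsto_nhds_unique (X := IdxRel le11)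
      (tendsto_lowerCenter11 (Or.inl rfl) hneg) (tendsto_lowerCenter11 (Or.inr rfl) hpos)))
end

section
/- Fix a real number a > 0 and let K := {(x, y) ∈ ℝ × ℝ : y < 0} carry the partial order: (x₁, y₁) ≤ (x₂, y₂) iff (x₁, y₁) = (x₂, y₂) or y₂ − y₁ > a·|x₂ − x₁|. For i ∈ ℝ set K_i := {(x, y) ∈ K : −y > a·|i − x|}. Then a subset S ⊆ K is a maximal upward directed subset of K if and only if S = K_i for some i ∈ ℝ; in particular K = ⋃_{i ∈ ℝ} K_i. -/
/-- The open lower half-plane `K = {(x, y) ∈ ℝ × ℝ : y < 0}` as a type. -/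
def K13 : Type := {p : ℝ × ℝ // p.2 < 0}

/-- The partial order on `K13`: `(x₁,y₁) ≤ (x₂,y₂)` iff they are equal or
`y₂ - y₁ > a·|x₂ - x₁|`. -/
def le13 (a : ℝ) (p q : K13) : Prop :=
  p = q ∨ q.1.2 - p.1.2 > a * |q.1.1 - p.1.1|

/-- `K_i = {(x, y) ∈ K : -y > a·|i - x|}`. -/
def K13i (a i : ℝ) : Set K13 := {p : K13 | -p.1.2 > a * |i - p.1.1|}

theorem mem_K13i_iff {a : ℝ} (ha : 0 < a) (i : ℝ) (p : K13) :
    p ∈ K13i a i ↔ a * p.1.1 + p.1.2 < a * i ∧ a * i < a * p.1.1 - p.1.2 := by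
  change a * |i - p.1.1| < -p.1.2 ↔ _
  rw [← abs_of_pos ha, ← abs_mul, abs_of_pos ha, abs_lt]
  constructor <;> rintro ⟨h₁, h₂⟩ <;> constructor <;> linarith

theorem le13_iff {a : ℝ} (ha : 0 < a) (p q : K13) :
    le13 a p q ↔ p = q ∨ (a * p.1.1 + p.1.2 < a * q.1.1 + q.1.2 ∧
      a * q.1.1 - q.1.2 < a * p.1.1 - p.1.2) := by
  change (p = q ∨ a * |q.1.1 - p.1.1| < q.1.2 - p.1.2) ↔ _
  rw [← abs_of_pos ha, ← abs_mul, abs_of_pos ha, abs_lt]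
  refine or_congr Iff.rfl ?_
  constructor <;> rintro ⟨h₁, h₂⟩ <;> constructor <;> linarith

theorem mem_K13i_self (a : ℝ) (p : K13) : p ∈ K13i a p.1.1 := by
  change a * |p.1.1 - p.1.1| < -p.1.2
  simpa using p.2

theorem isUpDirectedRel_K13i (a i : ℝ) : IsUpDirectedRel (le13 a) (K13i a i) := by
  intro p hp q hq
  change a * |i - p.1.1| < -p.1.2 at hp
  change a * |i - q.1.1| < -q.1.2 at hq
  obtain ⟨ε, hε, hεm⟩ := exists_between
    (lt_min (sub_pos.2 hp) (sub_pos.2 hq))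
  obtain ⟨h₁, h₂⟩ := lt_min_iff.1 hεm
  let c : K13 := ⟨(i, -ε), neg_lt_zero.2 hε⟩
  refine ⟨c, mem_K13i_self a c, Or.inr ?_, Or.inr ?_⟩
  · change a * |i - p.1.1| < -ε - p.1.2
    linarith
  · change a * |i - q.1.1| < -ε - q.1.2
    linarith

theorem IsUpDirectedRel.exists_subset_K13i {a : ℝ} (ha : 0 < a) {S : Set K13}
    (hS : IsUpDirectedRel (le13 a) S) : ∃ i : ℝ, S ⊆ K13i a i := by
  by_cases hmax : ∃ p ∈ S, ∀ q ∈ S, le13 a q p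
  · obtain ⟨p, -, hp⟩ := hmax
    refine ⟨p.1.1, fun q hq => ?_⟩
    rcases hp q hq with rfl | h
    · exact mem_K13i_self a q
    · have hp₀ := p.2
      change a * |p.1.1 - q.1.1| < -q.1.2
      linarith
  push Not at hmax
  have hlr : ∀ p ∈ S, ∀ q ∈ S, a * p.1.1 + p.1.2 ≤ a * q.1.1 - q.1.2 := by
    intro p hp q hq
    obtain ⟨c, -, hpc, hqc⟩ := hS p hp q hq
    have hc := c.2
    rw [le13_iff ha] at hpc hqc
    rcases hpc with rfl | ⟨h₁, h₂⟩ <;> rcases hqc with rfl | ⟨h₃, h₄⟩ <;> linarith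
  let L : Set ℝ := (fun p : K13 => a * p.1.1 + p.1.2) '' S
  refine ⟨sSup L / a, fun p hp => ?_⟩
  obtain ⟨q, hq, hqp⟩ := hmax p hp
  obtain ⟨c, hc, hpc, hqc⟩ := hS p hp q hq
  have hpc' : p ≠ c := by
    rintro rfl
    exact hqp hqc
  obtain ⟨h₁, h₂⟩ := ((le13_iff ha p c).1 hpc).resolve_left hpc'
  have hbound : ∀ x ∈ L, x ≤ a * c.1.1 - c.1.2 := by
    rintro _ ⟨r, hr, rfl⟩
    exact hlr r hr c hc
  have hcL : a * c.1.1 + c.1.2 ∈ L := ⟨c, hc, rfl⟩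
  rw [mem_K13i_iff ha, mul_div_cancel₀ _ ha.ne']
  exact ⟨h₁.trans_le (le_csSup ⟨_, hbound⟩ hcL), (csSup_le ⟨_, hcL⟩ hbound).trans_lt h₂⟩

theorem eq_of_K13i_subset_K13i {a : ℝ} (ha : 0 < a) {i j : ℝ} (h : K13i a i ⊆ K13i a j) :
    i = j := by
  by_contra hij
  have hpos : 0 < a * |j - i| := mul_pos ha (abs_pos.2 (sub_ne_zero.2 (Ne.symm hij)))
  let c : K13 := ⟨(i, -(a * |j - i|)), neg_lt_zero.2 hpos⟩
  have hc : a * |j - i| < - -(a * |j - i|) := h (mem_K13i_self a c)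
  linarith

/-- For `a > 0`, a subset `S ⊆ K` is a maximal upward directed subset iff `S = K_i`
for some `i ∈ ℝ`; in particular `K = ⋃ i, K_i`. -/
theorem maximal_upward_directed_iff (a : ℝ) (ha : 0 < a) :
    (∀ S : Set K13, IsMaxUpDirectedRel (le13 a) S ↔ ∃ i : ℝ, S = K13i a i) ∧
    (⋃ i : ℝ, K13i a i) = Set.univ := by
  refine ⟨fun S => ⟨?_, ?_⟩, Set.eq_univ_of_forall fun p =>
    Set.mem_iUnion.2 ⟨p.1.1, mem_K13i_self a p⟩⟩
  · rintro ⟨hS, hmax⟩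
    obtain ⟨i, hi⟩ := hS.exists_subset_K13i ha
    exact ⟨i, (hmax _ (isUpDirectedRel_K13i a i) hi).symm⟩
  · rintro ⟨i, rfl⟩
    refine ⟨isUpDirectedRel_K13i a i, fun T hT hiT => ?_⟩
    obtain ⟨j, hj⟩ := hT.exists_subset_K13i ha
    obtain rfl := eq_of_K13i_subset_K13i ha (hiT.trans hj)
    exact hj.antisymm hiT
end

section
/- Let K := {(n, m) ∈ ℤ × ℤ : m ≤ 0} carry the partial order: (n₁, m₁) ≤ (n₂, m₂) iff m₂ − m₁ ≥ n₂ − n₁ ≥ 0. For i ∈ ℤ set K_i := {(n, m) ∈ K : 0 ≤ i − n ≤ −m}. Then a subset S ⊆ K is a maximal upward directed subset of K if and only if S = K_i for some i ∈ ℤ; in particular K = ⋃_{i ∈ ℤ} K_i. -/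
/-- The set `K = {(n, m) ∈ ℤ × ℤ : m ≤ 0}` as a type. -/
def K15 : Type := {p : ℤ × ℤ // p.2 ≤ 0}

/-- The partial order on `K15`: `(n₁,m₁) ≤ (n₂,m₂)` iff `m₂ - m₁ ≥ n₂ - n₁ ≥ 0`. -/
def le15 (p q : K15) : Prop :=
  q.1.2 - p.1.2 ≥ q.1.1 - p.1.1 ∧ q.1.1 - p.1.1 ≥ 0

/-- `K_i = {(n, m) ∈ K : 0 ≤ i - n ≤ -m}`. -/
def K15i (i : ℤ) : Set K15 := {p : K15 | 0 ≤ i - p.1.1 ∧ i - p.1.1 ≤ -p.1.2}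

/-- The element `(i, 0)` of `K15`, the greatest element of `K15i i`. -/
def K15.ofInt (i : ℤ) : K15 := ⟨(i, 0), le_rfl⟩

theorem mem_K15i (i : ℤ) (p : K15) : p ∈ K15i i ↔ 0 ≤ i - p.1.1 ∧ i - p.1.1 ≤ -p.1.2 :=
  Iff.rfl

theorem mem_K15i_iff_le15 (i : ℤ) (p : K15) : p ∈ K15i i ↔ le15 p (K15.ofInt i) := by
  simp only [mem_K15i, le15, K15.ofInt]
  omega

theorem le15_trans {p q r : K15} (hpq : le15 p q) (hqr : le15 q r) : le15 p r := by
  simp only [le15] at *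
  omega

theorem ofInt_mem_K15i (i : ℤ) : K15.ofInt i ∈ K15i i := by
  rw [mem_K15i]
  simp [K15.ofInt]

theorem mem_K15i_fst (p : K15) : p ∈ K15i p.1.1 := by
  have := p.2
  rw [mem_K15i]
  omega

theorem isUpDirectedRel_K15i (i : ℤ) : IsUpDirectedRel le15 (K15i i) := fun a ha b hb =>
  ⟨K15.ofInt i, ofInt_mem_K15i i, (mem_K15i_iff_le15 i a).1 ha, (mem_K15i_iff_le15 i b).1 hb⟩

/-- A nonempty upward directed subset has a greatest element, namely any element with maximal
second coordinate. -/
theorem IsUpDirectedRel.exists_greatest_le15 {S : Set K15} (hS : IsUpDirectedRel le15 S)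
    (hne : S.Nonempty) : ∃ a ∈ S, ∀ b ∈ S, le15 b a := by
  obtain ⟨a, ha, hmin⟩ := (measure fun p : K15 => (-p.1.2).toNat).wf.has_min S hne
  refine ⟨a, ha, fun b hb => ?_⟩
  obtain ⟨c, hc, hac, hbc⟩ := hS a ha b hb
  have hca : ¬ (-c.1.2).toNat < (-a.1.2).toNat := hmin c hc
  have hc0 := c.2
  have ha0 := a.2
  simp only [le15] at *
  omega

theorem IsUpDirectedRel.exists_subset_K15i {S : Set K15} (hS : IsUpDirectedRel le15 S) :
    ∃ i : ℤ, S ⊆ K15i i := by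
  rcases S.eq_empty_or_nonempty with rfl | hne
  · exact ⟨0, Set.empty_subset _⟩
  · obtain ⟨a, -, hmax⟩ := hS.exists_greatest_le15 hne
    exact ⟨a.1.1, fun b hb => (mem_K15i_iff_le15 _ b).2
      (le15_trans (hmax b hb) ((mem_K15i_iff_le15 _ a).1 (mem_K15i_fst a)))⟩

theorem eq_of_K15i_subset {i j : ℤ} (h : K15i i ⊆ K15i j) : i = j := by
  have := (mem_K15i j _).1 (h (ofInt_mem_K15i i))
  simp only [K15.ofInt] at this
  omega

/-- A subset `S ⊆ K` is a maximal upward directed subset iff `S = K_i` for some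
`i ∈ ℤ`; in particular `K = ⋃ i, K_i`. -/
theorem maximal_upward_directed_iff_int :
    (∀ S : Set K15, IsMaxUpDirectedRel le15 S ↔ ∃ i : ℤ, S = K15i i) ∧
    (⋃ i : ℤ, K15i i) = Set.univ := by
  refine ⟨fun S => ⟨fun ⟨hS, hmax⟩ => ?_, ?_⟩, ?_⟩
  · obtain ⟨i, hi⟩ := hS.exists_subset_K15i
    exact ⟨i, (hmax _ (isUpDirectedRel_K15i i) hi).symm⟩
  · rintro ⟨i, rfl⟩
    refine ⟨isUpDirectedRel_K15i i, fun T hT hiT => ?_⟩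
    obtain ⟨j, hj⟩ := hT.exists_subset_K15i
    obtain rfl := eq_of_K15i_subset (hiT.trans hj)
    exact hj.antisymm hiT
  · exact Set.eq_univ_of_forall fun p => Set.mem_iUnion.2 ⟨p.1.1, mem_K15i_fst p⟩
end

section
/- Let a ∈ K and let S be a maximal upward directed subset of K with U_a = {S}. Then for every b ∈ K with a ≤ b one has b ∈ S and U_b = {S}. -/
/-- A maximal upward directed subset is downward closed. -/
theorem IsMaxUpDirected.mem_of_le {K : Type*} [PartialOrder K] {S : Set K}
    (hS : IsMaxUpDirected S) {a b : K} (hab : a ≤ b) (hb : b ∈ S) : a ∈ S := by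
  have hdir : IsUpDirected {x | ∃ y ∈ S, x ≤ y} := by
    rintro x ⟨y, hy, hxy⟩ x' ⟨y', hy', hxy'⟩
    obtain ⟨c, hc, hyc, hyc'⟩ := hS.1 y hy y' hy'
    exact ⟨c, ⟨c, hc, le_rfl⟩, hxy.trans hyc, hxy'.trans hyc'⟩
  rw [← hS.2 _ hdir fun x hx => ⟨x, hx, le_rfl⟩]
  exact ⟨b, hb, hab⟩

/-- Every upward directed subset is contained in a maximal one. -/
theorem IsUpDirected.exists_isMaxUpDirected_superset {K : Type*} [PartialOrder K] {S : Set K}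
    (hS : IsUpDirected S) : ∃ M, S ⊆ M ∧ IsMaxUpDirected M := by
  obtain ⟨M, hSM, hM⟩ := zorn_subset_nonempty {T : Set K | IsUpDirected T}
    (fun c hc hchain _ => by
      refine ⟨⋃₀ c, ?_, fun s hs => Set.subset_sUnion_of_mem hs⟩
      rintro x ⟨s, hs, hx⟩ y ⟨t, ht, hy⟩
      rcases hchain.total hs ht with hst | hts
      · obtain ⟨z, hz, hxz, hyz⟩ := hc ht x (hst hx) y hy
        exact ⟨z, ⟨t, ht, hz⟩, hxz, hyz⟩
      · obtain ⟨z, hz, hxz, hyz⟩ := hc hs x hx y (hts hy)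
        exact ⟨z, ⟨s, hs, hz⟩, hxz, hyz⟩) S hS
  exact ⟨M, hSM, hM.prop, fun T hT hMT => (hM.le_of_ge hT hMT).antisymm hMT⟩

/-- If `U a = {S}` then every `b ≥ a` lies in `S` and satisfies `U b = {S}`. -/
theorem U_singleton_of_le {K : Type*} [PartialOrder K] (a : K)
    (S : Set K) (hS : IsMaxUpDirected S)
    (h : U a = {(⟨S, hS⟩ : Idx K)}) :
    ∀ b : K, a ≤ b → b ∈ S ∧ U b = {(⟨S, hS⟩ : Idx K)} := by
  intro b hab
  have eq_of_mem : ∀ T : Idx K, a ∈ T.1 → T = ⟨S, hS⟩ := fun T hT => by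
    have hTU : T ∈ U a := hT
    rwa [h] at hTU
  have hdir : IsUpDirected ({a, b} : Set K) := by
    have le_b : ∀ x ∈ ({a, b} : Set K), x ≤ b := by
      rintro x (rfl | rfl)
      exacts [hab, le_rfl]
    exact fun x hx y hy => ⟨b, Or.inr rfl, le_b x hx, le_b y hy⟩
  obtain ⟨M, hsub, hM⟩ := hdir.exists_isMaxUpDirected_superset
  have hMS : M = S := congrArg Subtype.val (eq_of_mem ⟨M, hM⟩ (hsub (Or.inl rfl)))
  have hbS : b ∈ S := hMS ▸ hsub (Or.inr rfl)
  refine ⟨hbS, Set.Subset.antisymm (fun T hT => eq_of_mem T (T.2.mem_of_le hab hT)) ?_⟩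
  rintro _ rfl
  exact hbS
end

section
/- Let S ∈ I be a point admitting a countable neighbourhood base in the topological space (I, τ). Then there exists a sequence (a_n)_{n ∈ ℕ} of elements of S such that a_n ≤ a_{n+1} and U_{a_{n+1}} ⊆ U_{a_n} for all n, and the family {U_{a_n} : n ∈ ℕ} is a neighbourhood base at S, i.e., every τ-open set containing S contains U_{a_n} for some n. -/
namespace IsMaxUpDirected

variable {K : Type*} [PartialOrder K] {S : Set K}

theorem mem_of_le_s19 (hS : IsMaxUpDirected S) {a b : K} (hab : a ≤ b) (hb : b ∈ S) : a ∈ S := by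
  have hdir : IsUpDirected {x : K | ∃ y ∈ S, x ≤ y} := by
    rintro x ⟨x', hx', hx⟩ y ⟨y', hy', hy⟩
    obtain ⟨c, hc, hxc, hyc⟩ := hS.1 x' hx' y' hy'
    exact ⟨c, ⟨c, hc, le_rfl⟩, hx.trans hxc, hy.trans hyc⟩
  have heq := hS.2 _ hdir fun x hx => ⟨x, hx, le_rfl⟩
  rw [← heq]
  exact ⟨b, hb, hab⟩

theorem nonempty [Nonempty K] (hS : IsMaxUpDirected S) : S.Nonempty := by
  by_contra h
  rw [Set.not_nonempty_iff_eq_empty] at h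
  subst h
  obtain ⟨x⟩ := ‹Nonempty K›
  refine Set.singleton_ne_empty x (hS.2 {x} ?_ (Set.empty_subset _))
  rintro a rfl b rfl
  exact ⟨_, rfl, le_rfl, le_rfl⟩

end IsMaxUpDirected

theorem U_antitone_s19 {K : Type*} [PartialOrder K] : Antitone (U : K → Set (Idx K)) :=
  fun _ _ hab T hT => T.2.mem_of_le_s19 hab hT

theorem exists_U_subset_of_isOpen {K : Type*} [PartialOrder K] [Nonempty K] {S : Idx K}
    {V : Set (Idx K)} (hV : (tau K).IsOpen V) (hS : S ∈ V) : ∃ a ∈ S.1, U a ⊆ V := by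
  change TopologicalSpace.GenerateOpen _ V at hV
  induction hV with
  | basic V hV =>
    obtain ⟨a, rfl⟩ := hV
    exact ⟨a, hS, subset_rfl⟩
  | univ =>
    obtain ⟨a, ha⟩ := S.2.nonempty
    exact ⟨a, ha, Set.subset_univ _⟩
  | inter V W _ _ ihV ihW =>
    obtain ⟨a, ha, haV⟩ := ihV hS.1
    obtain ⟨b, hb, hbW⟩ := ihW hS.2
    obtain ⟨c, hc, hac, hbc⟩ := S.2.1 a ha b hb
    exact ⟨c, hc, Set.subset_inter ((U_antitone_s19 hac).trans haV) ((U_antitone_s19 hbc).trans hbW)⟩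
  | sUnion F _ ih =>
    obtain ⟨V, hVF, hSV⟩ := hS
    obtain ⟨a, ha, haV⟩ := ih V hVF hSV
    exact ⟨a, ha, haV.trans (Set.subset_sUnion_of_mem hVF)⟩

/-- If `S ∈ I` admits a countable neighbourhood base in `(I, τ)`, then there is a
sequence `a : ℕ → K` of elements of `S` with `a n ≤ a (n+1)`,
`U (a (n+1)) ⊆ U (a n)`, and such that the family `{U (a n)}` is a neighbourhood
base at `S`: every `τ`-open set containing `S` contains some `U (a n)`. -/
theorem exists_increasing_nbhd_base {K : Type*} [PartialOrder K] [Nonempty K]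
    (S : Idx K) (B : ℕ → Set (Idx K))
    (hnbhd : ∀ n : ℕ, ∃ V : Set (Idx K), (tau K).IsOpen V ∧ S ∈ V ∧ V ⊆ B n)
    (hbase : ∀ V : Set (Idx K), (tau K).IsOpen V → S ∈ V → ∃ n : ℕ, B n ⊆ V) :
    ∃ a : ℕ → K,
      (∀ n : ℕ, a n ∈ S.1) ∧ (∀ n : ℕ, a n ≤ a (n + 1)) ∧
      (∀ n : ℕ, U (a (n + 1)) ⊆ U (a n)) ∧
      (∀ V : Set (Idx K), (tau K).IsOpen V → S ∈ V → ∃ n : ℕ, U (a n) ⊆ V) := by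
  have hB : ∀ n, ∃ b : S.1, U b.1 ⊆ B n := fun n => by
    obtain ⟨V, hV, hSV, hVB⟩ := hnbhd n
    obtain ⟨b, hb, hbV⟩ := exists_U_subset_of_isOpen hV hSV
    exact ⟨⟨b, hb⟩, hbV.trans hVB⟩
  choose b hb using hB
  have hub : ∀ x y : S.1, ∃ z : S.1, x ≤ z ∧ y ≤ z := fun x y => by
    obtain ⟨c, hc, hxc, hyc⟩ := S.2.1 x x.2 y y.2
    exact ⟨⟨c, hc⟩, hxc, hyc⟩
  choose ub hle_left hle_right using hub
  let a : ℕ → S.1 := fun n => Nat.rec (b 0) (fun k x => ub x (b k)) n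
  have hmono : ∀ n, (a n).1 ≤ (a (n + 1)).1 := fun n => hle_left (a n) (b n)
  have hdom : ∀ n, (b n).1 ≤ (a (n + 1)).1 := fun n => hle_right (a n) (b n)
  refine ⟨fun n => (a n).1, fun n => (a n).2, hmono, fun n => U_antitone_s19 (hmono n), ?_⟩
  intro V hV hSV
  obtain ⟨n, hn⟩ := hbase V hV hSV
  exact ⟨n + 1, (U_antitone_s19 (hdom n)).trans ((hb n).trans hn)⟩
end
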